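/- Let p : ℕ → [0,1] satisfy n^{−3/4 + 3/(2 log n)} ≤ p(n) ≤ n^{−3/4 + 2/log n} for all large n. Then 2.598^n · P_{n,p(n)}(D(A,B) contains no stable 6-cycle) → 0 as n → ∞. -/

import Mathlib

open MeasureTheory Filter Finset
open scoped ENNReal

noncomputable def entryWeight (p : ℝ) (b : Bool) : ℝ≥0∞ :=
  if b then ENNReal.ofReal p else ENNReal.ofReal (1 - p)

noncomputable def pairWeight (n : ℕ) (p : ℝ)
    (ω : (Fin n → Fin n → Bool) × (Fin n → Fin n → Bool)) : ℝ≥0∞ :=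
  (∏ i : Fin n, ∏ j : Fin n, entryWeight p (ω.1 i j)) *
    (∏ i : Fin n, ∏ j : Fin n, entryWeight p (ω.2 i j))

/-- The i.i.d. Bernoulli(p) measure `P_{n,p}` on pairs of n×n Boolean matrices. -/
noncomputable def gameMeasure (n : ℕ) (p : ℝ) :
    Measure ((Fin n → Fin n → Bool) × (Fin n → Fin n → Bool)) :=
  Measure.sum fun ω => pairWeight n p ω • Measure.dirac ω

/-- A directed 2ℓ-cycle in the bipartite digraph D(A,B): ℓ distinct rows and ℓ distinct
columns with B(i_k, j_k) = 1 and A(i_{k+1}, j_k) = 1 for all k (indices mod ℓ). -/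
def IsCycle (ℓ n : ℕ) (A B : Fin n → Fin n → Bool) (r c : ZMod ℓ → Fin n) : Prop :=
  Function.Injective r ∧ Function.Injective c ∧
    (∀ k, B (r k) (c k) = true) ∧ ∀ k, A (r (k + 1)) (c k) = true

/-- A stable 2ℓ-cycle: additionally, every row outside the cycle has at most one
out-neighbour (w.r.t. A) among the cycle's columns, and every column outside the cycle
has at most one in-neighbour (w.r.t. B) among the cycle's rows. -/
def IsStableCycle (ℓ n : ℕ) (A B : Fin n → Fin n → Bool) (r c : ZMod ℓ → Fin n) : Prop :=
  IsCycle ℓ n A B r c ∧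
    (∀ i : Fin n, i ∉ Set.range r →
      ∀ k k' : ZMod ℓ, A i (c k) = true → A i (c k') = true → c k = c k') ∧
    (∀ j : Fin n, j ∉ Set.range c →
      ∀ k k' : ZMod ℓ, B (r k) j = true → B (r k') j = true → r k = r k')

namespace RandomSubset

variable {ι : Type*} [Fintype ι]

/-- The weight of `s` under the law of the random subset containing each point independently
with probability `p`. -/
noncomputable def weight (p : ℝ) (s : Finset ι) : ℝ :=
  p ^ s.card * (1 - p) ^ (Fintype.card ι - s.card)

/-- The probability that the random subset of density `p` belongs to `Q`. -/
noncomputable def prob (p : ℝ) (Q : Set (Finset ι)) : ℝ :=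
  ∑ s, Q.indicator (weight p) s

variable {p : ℝ}

theorem weight_nonneg (h0 : 0 ≤ p) (h1 : p ≤ 1) (s : Finset ι) : 0 ≤ weight p s :=
  mul_nonneg (pow_nonneg h0 _) (pow_nonneg (sub_nonneg.2 h1) _)

theorem prob_univ : prob (ι := ι) p Set.univ = 1 := by
  simp [prob, weight, Fintype.sum_pow_mul_eq_add_pow]

theorem prob_mono (h0 : 0 ≤ p) (h1 : p ≤ 1) {Q R : Set (Finset ι)} (h : Q ⊆ R) :
    prob p Q ≤ prob p R :=
  sum_le_sum fun s _ => Set.indicator_le_indicator_of_subset h (weight_nonneg h0 h1) s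

theorem prob_nonneg (h0 : 0 ≤ p) (h1 : p ≤ 1) (Q : Set (Finset ι)) : 0 ≤ prob p Q :=
  sum_nonneg fun s _ => Set.indicator_nonneg (fun s _ => weight_nonneg h0 h1 s) s

theorem prob_inter_add_diff (Q R : Set (Finset ι)) :
    prob p (Q ∩ R) + prob p (Q \ R) = prob p Q := by
  rw [prob, prob, prob, ← sum_add_distrib]
  refine sum_congr rfl fun s _ => ?_
  by_cases hQ : s ∈ Q <;> by_cases hR : s ∈ R <;> simp [hQ, hR]

theorem prob_compl (Q : Set (Finset ι)) : prob p Qᶜ = 1 - prob p Q := by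
  have h := prob_inter_add_diff (p := p) Set.univ Q
  rw [Set.univ_inter, prob_univ, ← Set.compl_eq_univ_sdiff] at h
  linarith

theorem prob_union_le (h0 : 0 ≤ p) (h1 : p ≤ 1) (Q R : Set (Finset ι)) :
    prob p (Q ∪ R) ≤ prob p Q + prob p R := by
  rw [prob, prob, prob, ← sum_add_distrib]
  refine sum_le_sum fun s _ => ?_
  have := weight_nonneg h0 h1 s
  by_cases hQ : s ∈ Q <;> by_cases hR : s ∈ R <;> simp [hQ, hR, this]

theorem prob_biUnion_le (h0 : 0 ≤ p) (h1 : p ≤ 1) {κ : Type*} (T : Finset κ)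
    (Q : κ → Set (Finset ι)) :
    prob p {s | ∃ k ∈ T, s ∈ Q k} ≤ ∑ k ∈ T, prob p (Q k) := by
  classical
  induction T using Finset.induction_on with
  | empty => simp [prob]
  | insert k T hk ih =>
    rw [sum_insert hk]
    refine le_trans (prob_mono h0 h1 ?_) ((prob_union_le h0 h1 _ _).trans (add_le_add_right ih _))
    intro s hs
    simpa using hs

variable [DecidableEq ι]

theorem sum_eq_sum_powerset_erase (e : ι) (f : Finset ι → ℝ) :
    ∑ s, f s = ∑ t ∈ (univ.erase e).powerset, (f t + f (insert e t)) := by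
  rw [sum_add_distrib, ← sum_powerset_insert (notMem_erase e univ), insert_erase (mem_univ e),
    powerset_univ]

theorem prob_mem_inter (e : ι) (D : Set (Finset ι)) (hD : ∀ s, insert e s ∈ D ↔ s ∈ D) :
    prob p ({s | e ∈ s} ∩ D) = p * prob p D := by
  rw [prob, prob, sum_eq_sum_powerset_erase e, sum_eq_sum_powerset_erase e, mul_sum]
  refine sum_congr rfl fun t ht => ?_
  have het : e ∉ t := fun h => notMem_erase e univ (mem_powerset.1 ht h)
  have hcard : (insert e t).card = t.card + 1 := card_insert_of_notMem het
  have hle : (insert e t).card ≤ Fintype.card ι := card_le_univ _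
  obtain ⟨c, hc⟩ := Nat.exists_eq_add_of_le hle
  have h1 : Fintype.card ι - t.card = c + 1 := by omega
  have h2 : Fintype.card ι - (t.card + 1) = c := by omega
  by_cases h : t ∈ D
  · have h' : insert e t ∈ D := (hD t).2 h
    simp only [Set.indicator, Set.mem_inter_iff, Set.mem_ofPred_eq, het, h, h', mem_insert_self,
      false_and, true_and, if_true, if_false, weight, h1, h2, hcard]
    ring
  · have h' : insert e t ∉ D := fun h' => h ((hD t).1 h')
    simp [h, h']

theorem prob_superset_inter (E : Finset ι) (D : Set (Finset ι))
    (hD : ∀ e ∈ E, ∀ s, insert e s ∈ D ↔ s ∈ D) :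
    prob p ({s | E ⊆ s} ∩ D) = p ^ E.card * prob p D := by
  induction E using Finset.induction_on with
  | empty => simp
  | insert e E he ih =>
    have hset : {s : Finset ι | insert e E ⊆ s} ∩ D = {s | e ∈ s} ∩ ({s | E ⊆ s} ∩ D) := by
      ext s; simp [insert_subset_iff, and_assoc]
    rw [hset, prob_mem_inter, ih fun x hx => hD x (mem_insert_of_mem hx),
      card_insert_of_notMem he]
    · ring
    · intro s
      simp only [Set.mem_inter_iff, Set.mem_ofPred_eq, subset_insert_iff_of_notMem he,
        hD e (mem_insert_self e E)]

theorem prob_superset (E : Finset ι) : prob p {s | E ⊆ s} = p ^ E.card := by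
  simpa [prob_univ] using prob_superset_inter (p := p) E Set.univ (by simp)

/-- Harris' inequality for an increasing event of the form `E ⊆ s` and a decreasing event. -/
theorem prob_superset_inter_le (h0 : 0 ≤ p) (h1 : p ≤ 1) (E : Finset ι) {D : Set (Finset ι)}
    (hD : IsLowerSet D) : prob p ({s | E ⊆ s} ∩ D) ≤ p ^ E.card * prob p D := by
  have hmono : ∀ Q : Set (Finset ι), IsUpperSet Q → Monotone (Q.indicator (1 : Finset ι → ℝ)) := by
    intro Q hQ s t hst
    by_cases hs : s ∈ Q
    · simp [hs, hQ hst hs]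
    · rw [Set.indicator_of_notMem hs]; exact Set.indicator_nonneg (fun _ _ => zero_le_one) t
  have hprob : ∀ Q : Set (Finset ι), ∑ s, weight p s * Q.indicator 1 s = prob p Q := by
    intro Q
    refine sum_congr rfl fun s _ => ?_
    by_cases hs : s ∈ Q <;> simp [hs]
  have key := fkg (Set.indicator {s | E ⊆ s} 1) (Set.indicator Dᶜ 1) (weight (ι := ι) p)
    (weight_nonneg h0 h1) (fun s => Set.indicator_nonneg (fun _ _ => zero_le_one) s)
    (fun s => Set.indicator_nonneg (fun _ _ => zero_le_one) s)
    (hmono _ fun s t hst hs => Finset.Subset.trans hs hst) (hmono _ hD.compl) (by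
      intro s t
      have hc : (s ∩ t).card + (s ∪ t).card = s.card + t.card := card_inter_add_card_union s t
      have hs := card_le_univ s
      have ht := card_le_univ t
      have hi := card_le_univ (s ∩ t)
      have hu := card_le_univ (s ∪ t)
      refine le_of_eq ?_
      simp only [weight, Finset.inf_eq_inter, Finset.sup_eq_union]
      rw [mul_mul_mul_comm, ← pow_add, ← pow_add, mul_mul_mul_comm, ← pow_add, ← pow_add, hc]
      congr 2
      omega)
  have h2 : ∀ s, (Set.indicator {s | E ⊆ s} 1 s : ℝ) * Set.indicator Dᶜ 1 s
      = Set.indicator ({s | E ⊆ s} \ D) 1 s := by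
    intro s
    by_cases hE : E ⊆ s <;> by_cases hs : s ∈ D <;> simp [hE, hs]
  have htot : ∑ s, weight (ι := ι) p s = 1 := by
    simpa [prob] using prob_univ (ι := ι) (p := p)
  simp only [h2, hprob, htot, one_mul, prob_superset, prob_compl] at key
  have := prob_inter_add_diff (p := p) {s | E ⊆ s} D
  rw [prob_superset] at this
  linarith

/-- A form of Janson's inequality: if the correlations of each event `E k ⊆ s` with the other
ones it meets add up to at most half of its probability, the probability that none of these
events happens is at most what it would be for independent events of half the probability. -/
theorem prob_forall_not_superset_le (h0 : 0 ≤ p) (h1 : p ≤ 1) {κ : Type*} [DecidableEq κ]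
    (T : Finset κ) (E : κ → Finset ι) (d : ℕ) (hE : ∀ k ∈ T, (E k).card = d)
    (hT : ∀ k ∈ T, ∑ j ∈ T with j ≠ k ∧ ¬ Disjoint (E j) (E k), p ^ (E j ∪ E k).card
      ≤ p ^ d / 2) :
    prob p {s | ∀ k ∈ T, ¬ E k ⊆ s} ≤ (1 - p ^ d / 2) ^ T.card := by
  have hpd : p ^ d ≤ 1 := pow_le_one₀ h0 h1
  induction T using Finset.induction_on with
  | empty => simp [prob_univ]
  | insert k T hk ih =>
    have hkT : ∀ j ∈ T, j ≠ k := fun j hj h => hk (h ▸ hj)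
    have ih' := ih (fun j hj => hE j (mem_insert_of_mem hj)) fun j hj =>
      le_trans (sum_le_sum_of_subset_of_nonneg
        (filter_subset_filter _ (subset_insert k T)) fun i _ _ => pow_nonneg h0 _)
        (hT j (mem_insert_of_mem hj))
    set D : Set (Finset ι) := {s | ∀ j ∈ T, ¬ E j ⊆ s} with hDdef
    set D₁ : Set (Finset ι) := {s | ∀ j ∈ T, Disjoint (E j) (E k) → ¬ E j ⊆ s} with hD₁def
    have hD₁ : IsLowerSet D₁ := fun s t hst hs j hj hd hjt => hs j hj hd (hjt.trans hst)
    have hDD₁ : D ⊆ D₁ := fun s hs j hj _ => hs j hj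
    have hind : prob p ({s | E k ⊆ s} ∩ D₁) = p ^ d * prob p D₁ := by
      rw [prob_superset_inter, hE k (mem_insert_self k T)]
      intro e he s
      refine forall₂_congr fun j hj => forall_congr' fun hd => not_congr ?_
      exact subset_insert_iff_of_notMem fun hej => disjoint_left.1 hd hej he
    have hsum : prob p ({s | E k ⊆ s} ∩ D₁) ≤ prob p ({s | E k ⊆ s} ∩ D) +
        ∑ j ∈ T with ¬ Disjoint (E j) (E k), prob p ({s | E j ∪ E k ⊆ s} ∩ D₁) := by
      refine le_trans (prob_mono h0 h1 ?_)
        ((prob_union_le h0 h1 _ _).trans (add_le_add_right (prob_biUnion_le h0 h1 _ _) _))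
      rintro s ⟨hks, hs⟩
      by_cases hsD : s ∈ D
      · exact Or.inl ⟨hks, hsD⟩
      · refine Or.inr ?_
        simp only [hDdef, Set.mem_ofPred_eq, not_forall, not_not] at hsD
        obtain ⟨j, hj, hjs⟩ := hsD
        exact ⟨j, mem_filter.2 ⟨hj, fun hd => hs j hj hd hjs⟩, union_subset hjs hks, hs⟩
    have hcorr : ∑ j ∈ T with ¬ Disjoint (E j) (E k), prob p ({s | E j ∪ E k ⊆ s} ∩ D₁)
        ≤ p ^ d / 2 * prob p D₁ := by
      refine (sum_le_sum fun j _ => prob_superset_inter_le h0 h1 _ hD₁).trans ?_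
      rw [← sum_mul]
      refine mul_le_mul_of_nonneg_right (le_trans ?_ (hT k (mem_insert_self k T)))
        (prob_nonneg h0 h1 _)
      refine sum_le_sum_of_subset_of_nonneg ?_ fun i _ _ => pow_nonneg h0 _
      intro j hj
      rw [mem_filter] at hj ⊢
      exact ⟨mem_insert_of_mem hj.1, hkT j hj.1, hj.2⟩
    have hset : {s | ∀ j ∈ insert k T, ¬ E j ⊆ s} = D \ {s | E k ⊆ s} := by
      ext s; simp [hDdef, and_comm]
    have hsplit := prob_inter_add_diff (p := p) D {s | E k ⊆ s}
    rw [Set.inter_comm] at hsplit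
    have hle := prob_mono h0 h1 hDD₁
    have hpd0 : 0 ≤ p ^ d := pow_nonneg h0 d
    rw [hset, card_insert_of_notMem hk, pow_succ]
    have h3 : prob p (D \ {s | E k ⊆ s}) ≤ prob p D * (1 - p ^ d / 2) := by
      nlinarith [mul_le_mul_of_nonneg_left hle hpd0]
    exact h3.trans (mul_le_mul_of_nonneg_right ih' (by linarith))

/-- The union bound over the `m`-element families of `d`-element sets which are disjoint. -/
theorem prob_exists_disjoint_family_le (h0 : 0 ≤ p) (h1 : p ≤ 1) {κ : Type*} [DecidableEq κ]
    (T : Finset κ) (E : κ → Finset ι) (d m : ℕ) :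
    prob p {s | ∃ K ∈ T.powersetCard m, (K.biUnion E).card = d * m ∧ K.biUnion E ⊆ s}
      ≤ (T.card * p ^ d) ^ m / m.factorial := by
  refine (prob_biUnion_le h0 h1 _ _).trans ?_
  have hK : ∀ K ∈ T.powersetCard m,
      prob p {s | (K.biUnion E).card = d * m ∧ K.biUnion E ⊆ s} ≤ p ^ (d * m) := by
    intro K _
    by_cases h : (K.biUnion E).card = d * m
    · simp only [h, true_and, prob_superset, le_refl]
    · simpa [h, prob] using pow_nonneg h0 (d * m)
  refine (sum_le_sum hK).trans ?_
  rw [sum_const, card_powersetCard, nsmul_eq_mul, mul_pow, ← pow_mul, mul_div_right_comm]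
  exact mul_le_mul_of_nonneg_right (Nat.choose_le_pow_div m T.card) (pow_nonneg h0 _)

end RandomSubset

namespace GameMeasure

open RandomSubset

/-- The positions of the entries of a pair of `n × n` matrices. -/
abbrev Entry (n : ℕ) : Type := (Fin n × Fin n) ⊕ (Fin n × Fin n)

/-- Pairs of Boolean matrices correspond to sets of entries. -/
def matricesEquiv (n : ℕ) :
    Finset (Entry n) ≃ (Fin n → Fin n → Bool) × (Fin n → Fin n → Bool) where
  toFun s := (fun i j => decide (Sum.inl (i, j) ∈ s), fun i j => decide (Sum.inr (i, j) ∈ s))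
  invFun ω := univ.filter fun e => Sum.elim (fun x => ω.1 x.1 x.2) (fun x => ω.2 x.1 x.2) e = true
  left_inv s := by ext e; rcases e with ⟨i, j⟩ | ⟨i, j⟩ <;> simp
  right_inv ω := by ext i j <;> simp

theorem pairWeight_matricesEquiv (n : ℕ) {p : ℝ} (h0 : 0 ≤ p) (h1 : p ≤ 1)
    (s : Finset (Entry n)) :
    pairWeight n p (matricesEquiv n s) = ENNReal.ofReal (weight p s) := by
  have h1' : 0 ≤ 1 - p := sub_nonneg.2 h1
  have h : pairWeight n p (matricesEquiv n s)
      = ∏ e : Entry n, if e ∈ s then ENNReal.ofReal p else ENNReal.ofReal (1 - p) := by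
    simp [pairWeight, entryWeight, matricesEquiv, Fintype.prod_sum_type, Fintype.prod_prod_type]
  rw [h, prod_ite, prod_const, prod_const, weight, ENNReal.ofReal_mul (pow_nonneg h0 _),
    ENNReal.ofReal_pow h0, ENNReal.ofReal_pow h1', filter_univ_mem, filter_not, filter_univ_mem,
    ← compl_eq_univ_sdiff, card_compl]

theorem toReal_gameMeasure (n : ℕ) {p : ℝ} (h0 : 0 ≤ p) (h1 : p ≤ 1)
    (S : Set ((Fin n → Fin n → Bool) × (Fin n → Fin n → Bool))) :
    (gameMeasure n p S).toReal = prob p (matricesEquiv n ⁻¹' S) := by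
  classical
  rw [gameMeasure, Measure.sum_apply _ S.toFinite.measurableSet, tsum_fintype,
    ← (matricesEquiv n).sum_comp, ENNReal.toReal_sum, prob]
  · refine sum_congr rfl fun s _ => ?_
    rw [Measure.smul_apply, Measure.dirac_apply, pairWeight_matricesEquiv n h0 h1]
    by_cases h : matricesEquiv n s ∈ S
    · simp [h, ENNReal.toReal_ofReal (weight_nonneg h0 h1 s)]
    · simp [h]
  · intro s _
    rw [Measure.smul_apply, Measure.dirac_apply, pairWeight_matricesEquiv n h0 h1]
    by_cases h : matricesEquiv n s ∈ S <;> simp [h]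

end GameMeasure

namespace LayeredCycle

open RandomSubset GameMeasure

/-- The positions on a 6-cycle: `(k, false)` is its `k`-th row and `(k, true)` its `k`-th
column. -/
abbrev Pos : Type := ZMod 3 × Bool

/-- The successor of a position on the 6-cycle. -/
def next (t : Pos) : Pos := if t.2 then (t.1 + 1, false) else (t.1, true)

theorem card_filter_next_mem_add_one_le : ∀ a : Finset Pos, a.Nonempty → a ≠ univ →
    (a.filter fun t => next t ∈ a).card + 1 ≤ a.card := by
  decide

section Arcs

variable {n : ℕ} {V : Type*} (φ : ZMod 3 × V ↪ Fin n)

/-- The `k`-th row of the layered cycle `z`. -/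
def row (z : Pos → V) (k : ZMod 3) : Fin n := φ (k, z (k, false))

/-- The `k`-th column of the layered cycle `z`. -/
def col (z : Pos → V) (k : ZMod 3) : Fin n := φ (k, z (k, true))

/-- The entry which is the arc of `z` leaving the position `t`. -/
def arc (z : Pos → V) (t : Pos) : Entry n :=
  if t.2 then Sum.inl (row φ z (t.1 + 1), col φ z t.1) else Sum.inr (row φ z t.1, col φ z t.1)

/-- The set of arcs of the layered cycle `z`. -/
def arcs (z : Pos → V) : Finset (Entry n) := univ.image (arc φ z)

/-- The positions of two arcs witnessing that the layered cycle `z` is not stable: the row `i` and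
the columns `k`, `k'` of `z`, or the column `i` and the rows `k`, `k'` of `z`. -/
def cherry (z : Pos → V) : Bool × Fin n × ZMod 3 × ZMod 3 → Finset (Entry n)
  | (false, i, k, k') => {Sum.inl (i, col φ z k), Sum.inl (i, col φ z k')}
  | (true, i, k, k') => {Sum.inr (row φ z k, i), Sum.inr (row φ z k', i)}

/-- The arcs of a layered cycle together with a witness that it is not stable. -/
def unstableArcs (x : (Pos → V) × (Bool × Fin n × ZMod 3 × ZMod 3)) : Finset (Entry n) :=
  arcs φ x.1 ∪ cherry φ x.1 x.2

variable {φ}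

theorem row_eq_row {z z' : Pos → V} {k k' : ZMod 3} (h : row φ z k = row φ z' k') :
    k = k' ∧ z (k, false) = z' (k, false) := by
  have := φ.injective h
  rw [Prod.mk.injEq] at this
  obtain ⟨rfl, h⟩ := this
  exact ⟨rfl, h⟩

theorem col_eq_col {z z' : Pos → V} {k k' : ZMod 3} (h : col φ z k = col φ z' k') :
    k = k' ∧ z (k, true) = z' (k, true) := by
  have := φ.injective h
  rw [Prod.mk.injEq] at this
  obtain ⟨rfl, h⟩ := this
  exact ⟨rfl, h⟩

theorem arc_eq_arc {z z' : Pos → V} {t t' : Pos} (h : arc φ z t = arc φ z' t') :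
    t = t' ∧ z t = z' t ∧ z (next t) = z' (next t) := by
  obtain ⟨k, b⟩ := t
  obtain ⟨k', b'⟩ := t'
  cases b <;> cases b' <;> simp only [arc, next, if_true, if_false, Sum.inl.injEq, Sum.inr.injEq,
    Prod.mk.injEq, reduceCtorEq, Bool.false_eq_true] at h ⊢
  · obtain ⟨hk, h1⟩ := row_eq_row h.1
    exact ⟨⟨hk, trivial⟩, h1, (col_eq_col h.2).2⟩
  · obtain ⟨hk, h1⟩ := col_eq_col h.2
    exact ⟨⟨hk, trivial⟩, h1, (row_eq_row h.1).2⟩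

theorem card_arcs (z : Pos → V) : (arcs φ z).card = 6 := by
  rw [arcs, card_image_of_injective _ fun t t' h => (arc_eq_arc h).1]
  decide

theorem card_arcs_union [DecidableEq V] {z z' : Pos → V} (hne : z' ≠ z)
    (hd : ¬ Disjoint (arcs φ z') (arcs φ z)) :
    2 ≤ #{t | z' t = z t} ∧ #{t | z' t = z t} ≤ 5 ∧
      13 - #{t | z' t = z t} ≤ (arcs φ z' ∪ arcs φ z).card := by
  set a : Finset Pos := {t | z' t = z t} with ha
  have hinter : (arcs φ z' ∩ arcs φ z).card ≤ (a.filter fun t => next t ∈ a).card := by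
    refine (card_le_card (t := (a.filter fun t => next t ∈ a).image (arc φ z)) ?_).trans
      card_image_le
    intro e he
    simp only [arcs, mem_inter, mem_image, mem_univ, true_and] at he
    obtain ⟨⟨t', ht'⟩, ⟨t, rfl⟩⟩ := he
    obtain ⟨rfl, h1, h2⟩ := arc_eq_arc ht'
    exact mem_image.2 ⟨_, by simp [ha, h1, h2], rfl⟩
  have hau : a ≠ univ := by
    intro h
    refine hne (funext fun t => ?_)
    simpa [ha] using (h ▸ mem_univ t : t ∈ a)
  have hpos : 0 < (arcs φ z' ∩ arcs φ z).card :=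
    card_pos.2 (not_disjoint_iff_nonempty_inter.1 hd)
  have hane : a.Nonempty := by
    obtain ⟨t, ht⟩ := card_pos.1 (hpos.trans_le hinter)
    exact ⟨t, (mem_filter.1 ht).1⟩
  have h1 := card_filter_next_mem_add_one_le a hane hau
  have h2 : a.card < 6 := card_lt_univ_of_notMem (x := (not_forall.1 fun h =>
    hau (eq_univ_iff_forall.2 h)).choose) (not_forall.1 fun h =>
    hau (eq_univ_iff_forall.2 h)).choose_spec
  have h3 := card_union_add_card_inter (arcs φ z') (arcs φ z)
  rw [card_arcs, card_arcs] at h3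
  omega

theorem mem_unstableArcs {x : (Pos → V) × (Bool × Fin n × ZMod 3 × ZMod 3)} {e : Entry n}
    (he : e ∈ unstableArcs φ x) :
    (∃ i k, e = Sum.inl (i, col φ x.1 k)) ∨ ∃ k j, e = Sum.inr (row φ x.1 k, j) := by
  obtain ⟨z, b, i, k, k'⟩ := x
  simp only [unstableArcs, mem_union, arcs, mem_image, mem_univ, true_and] at he
  rcases he with ⟨⟨l, c⟩, rfl⟩ | he
  · cases c <;> simp [arc]
  · cases b <;> simp only [cherry, mem_insert, mem_singleton] at he <;> rcases he with rfl | rfl <;>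
      simp

theorem disjoint_unstableArcs {x y : (Pos → V) × (Bool × Fin n × ZMod 3 × ZMod 3)}
    (h : ∀ t, x.1 t ≠ y.1 t) : Disjoint (unstableArcs φ x) (unstableArcs φ y) := by
  refine disjoint_left.2 fun e hx hy => ?_
  rcases mem_unstableArcs hx with ⟨i, k, rfl⟩ | ⟨k, j, rfl⟩ <;>
    rcases mem_unstableArcs hy with ⟨i', k', h'⟩ | ⟨k', j', h'⟩ <;>
    simp only [Sum.inl.injEq, Sum.inr.injEq, Prod.mk.injEq, reduceCtorEq] at h'
  · exact h _ (col_eq_col h'.2).2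
  · exact h _ (row_eq_row h'.1).2

theorem card_unstableArcs_false {z : Pos → V} {i : Fin n} {k k' : ZMod 3}
    (hi : i ∉ Set.range (row φ z)) (hk : col φ z k ≠ col φ z k') :
    (unstableArcs φ (z, false, i, k, k')).card = 8 := by
  rw [unstableArcs, card_union_of_disjoint, card_arcs, cherry, card_pair (by simpa using hk)]
  refine disjoint_left.2 fun e he he' => ?_
  simp only [arcs, mem_image, mem_univ, true_and] at he
  obtain ⟨⟨l, c⟩, rfl⟩ := he
  cases c <;> simp [cherry, arc] at he'
  rcases he' with h | h <;> exact hi ⟨_, h.1⟩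

theorem card_unstableArcs_true {z : Pos → V} {j : Fin n} {k k' : ZMod 3}
    (hj : j ∉ Set.range (col φ z)) (hk : row φ z k ≠ row φ z k') :
    (unstableArcs φ (z, true, j, k, k')).card = 8 := by
  rw [unstableArcs, card_union_of_disjoint, card_arcs, cherry, card_pair (by simpa using hk)]
  refine disjoint_left.2 fun e he he' => ?_
  simp only [arcs, mem_image, mem_univ, true_and] at he
  obtain ⟨⟨l, c⟩, rfl⟩ := he
  cases c <;> simp [cherry, arc] at he'
  rcases he' with h | h <;> exact hj ⟨_, h.2⟩

theorem exists_unstableArcs_subset {s : Finset (Entry n)}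
    (hs : ¬ ∃ r c : ZMod 3 → Fin n,
      IsStableCycle 3 n (matricesEquiv n s).1 (matricesEquiv n s).2 r c)
    {z : Pos → V} (hz : arcs φ z ⊆ s) :
    ∃ c, (unstableArcs φ (z, c)).card = 8 ∧ unstableArcs φ (z, c) ⊆ s := by
  have harc : ∀ t, arc φ z t ∈ s := fun t => hz (mem_image_of_mem _ (mem_univ t))
  have hcycle : IsCycle 3 n (matricesEquiv n s).1 (matricesEquiv n s).2 (row φ z) (col φ z) :=
    ⟨fun k k' h => (row_eq_row h).1, fun k k' h => (col_eq_col h).1,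
      fun k => by simpa [matricesEquiv, arc] using harc (k, false),
      fun k => by simpa [matricesEquiv, arc] using harc (k, true)⟩
  by_contra! hcon
  refine hs ⟨_, _, hcycle, fun i hi k k' h h' => ?_, fun j hj k k' h h' => ?_⟩
  · by_contra hk
    refine hcon (false, i, k, k') (card_unstableArcs_false hi hk) (union_subset hz ?_)
    simp only [matricesEquiv, Equiv.coe_fn_mk, decide_eq_true_eq] at h h'
    simp [cherry, insert_subset_iff, h, h']
  · by_contra hk
    refine hcon (true, j, k, k') (card_unstableArcs_true hj hk) (union_subset hz ?_)
    simp only [matricesEquiv, Equiv.coe_fn_mk, decide_eq_true_eq] at h h'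
    simp [cherry, insert_subset_iff, h, h']

/-- If there is no stable cycle then every family `F` of layered cycles either has no cycle
present outside a few vertices, or contains many vertex-disjoint present cycles, each of them
unstable. -/
theorem exists_avoiding_or_disjoint_unstable [DecidableEq V] {s : Finset (Entry n)}
    (hs : ¬ ∃ r c : ZMod 3 → Fin n,
      IsStableCycle 3 n (matricesEquiv n s).1 (matricesEquiv n s).2 r c)
    (F : Finset (Pos → V)) (m : ℕ) :
    (∃ U : Pos → Finset V, (∀ t, (U t).card ≤ m) ∧
      ∀ z ∈ F.filter (fun z => ∀ t, z t ∉ U t), ¬ arcs φ z ⊆ s) ∨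
    ∃ K ∈ (F ×ˢ (univ : Finset (Bool × Fin n × ZMod 3 × ZMod 3))).powersetCard m,
      (K.biUnion (unstableArcs φ)).card = 8 * m ∧ K.biUnion (unstableArcs φ) ⊆ s := by
  set P : Finset (Finset (Pos → V)) := F.powerset.filter fun K => K.card ≤ m ∧
    (∀ z ∈ K, arcs φ z ⊆ s) ∧ ∀ z ∈ K, ∀ z' ∈ K, z ≠ z' → ∀ t, z t ≠ z' t with hP
  have hne : P.Nonempty := ⟨∅, by simp [hP]⟩
  obtain ⟨K, hK, hmax⟩ := exists_max_image P card hne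
  simp only [hP, mem_filter, mem_powerset] at hK hmax
  obtain ⟨hKF, hKm, hKs, hKd⟩ := hK
  rcases hKm.lt_or_eq with hlt | heq
  · refine Or.inl ⟨fun t => K.image fun z => z t, fun t => card_image_le.trans hKm, ?_⟩
    intro z hz hzs
    simp only [mem_filter, mem_image, not_exists, not_and] at hz
    have hzK : z ∉ K := fun h => hz.2 (0, false) z h rfl
    have := hmax (insert z K) ⟨insert_subset hz.1 hKF, by rw [card_insert_of_notMem hzK]; omega,
      by simpa [hzs] using hKs, by
        intro x hx y hy hxy t
        rw [mem_insert] at hx hy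
        rcases hx with rfl | hx <;> rcases hy with rfl | hy
        · exact absurd rfl hxy
        · exact fun h => hz.2 t y hy h.symm
        · exact hz.2 t x hx
        · exact hKd x hx y hy hxy t⟩
    rw [card_insert_of_notMem hzK] at this
    omega
  · refine Or.inr ?_
    have hch : ∀ z ∈ K, ∃ c, (unstableArcs φ (z, c)).card = 8 ∧ unstableArcs φ (z, c) ⊆ s :=
      fun z hz => exists_unstableArcs_subset hs (hKs z hz)
    rcases K.eq_empty_or_nonempty with rfl | ⟨z₀, hz₀⟩
    · obtain rfl : m = 0 := by simpa using heq.symm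
      exact ⟨∅, by simp⟩
    have : Nonempty (Bool × Fin n × ZMod 3 × ZMod 3) := ⟨(hch z₀ hz₀).choose⟩
    choose! ch hch8 hchs using hch
    have hinj : Function.Injective fun z => (z, ch z) := fun z z' h => congrArg Prod.fst h
    refine ⟨K.image fun z => (z, ch z), mem_powersetCard.2 ⟨?_, ?_⟩, ?_, ?_⟩
    · exact image_subset_iff.2 fun z hz => mem_product.2 ⟨hKF hz, mem_univ _⟩
    · rw [card_image_of_injective _ hinj, heq]
    · rw [image_biUnion, card_biUnion fun z hz z' hz' hzz' =>
        disjoint_unstableArcs (hKd z hz z' hz' hzz'), sum_congr rfl hch8, sum_const, heq,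
        smul_eq_mul, mul_comm]
    · rw [image_biUnion]
      exact biUnion_subset.2 hchs

end Arcs


section Sparse

variable {M L : ℕ} [NeZero M] [NeZero L]

/-- A sparse family of layered cycles, in which any five vertices leave little choice for the
remaining one. -/
def sparseFamily (M L : ℕ) [NeZero M] [NeZero L] : Finset (Pos → ZMod M × ZMod L) :=
  univ.filter fun z => ∑ t, (z t).2 = 0

theorem card_sparseFamily_agree_le {a : Finset Pos} (ha : a ≠ univ) (w : Pos → ZMod M × ZMod L) :
    ((sparseFamily M L).filter fun z => ∀ t ∈ a, z t = w t).card ≤ M * (M * L) ^ (5 - a.card) := by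
  obtain ⟨t₀, ht₀⟩ : ∃ t, t ∉ a := not_forall.1 fun h => ha (eq_univ_iff_forall.2 h)
  let f : (Pos → ZMod M × ZMod L) → ZMod M × ({t // t ∉ insert t₀ a} → ZMod M × ZMod L) :=
    fun z => ((z t₀).1, fun t => z t)
  have hcard : Fintype.card (ZMod M × ({t // t ∉ insert t₀ a} → ZMod M × ZMod L))
      = M * (M * L) ^ (5 - a.card) := by
    have h1 : Fintype.card {t // t ∉ insert t₀ a} = 5 - a.card := by
      rw [Fintype.card_subtype_compl, Fintype.card_coe, card_insert_of_notMem ht₀,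
        show Fintype.card Pos = 6 from rfl]
      omega
    rw [Fintype.card_prod, Fintype.card_fun, h1, Fintype.card_prod, ZMod.card, ZMod.card]
  rw [← hcard, ← card_univ]
  refine card_le_card_of_injOn f (fun _ _ => mem_coe.2 (mem_univ _)) ?_
  intro z hz z' hz' h
  simp only [sparseFamily, coe_filter, mem_filter, mem_univ, true_and] at hz hz'
  obtain ⟨h1, h2⟩ := Prod.mk.inj h
  have hne : ∀ t, t ≠ t₀ → z t = z' t := by
    intro t ht
    by_cases hta : t ∈ a
    · rw [hz.2 t hta, hz'.2 t hta]
    · exact congrFun h2 ⟨t, by simp [ht, hta]⟩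
  have hsum : ∑ t, (z t).2 = ∑ t, (z' t).2 := hz.1.trans hz'.1.symm
  rw [← add_sum_erase univ _ (mem_univ t₀), ← add_sum_erase univ (fun t => (z' t).2) (mem_univ t₀),
    sum_congr rfl fun t ht => by rw [hne t (ne_of_mem_erase ht)]] at hsum
  funext t
  by_cases ht : t = t₀
  · subst ht
    exact Prod.ext h1 (add_right_cancel hsum)
  · exact hne t ht

theorem card_sparseFamily_le : (sparseFamily M L).card ≤ M * (M * L) ^ 5 := by
  simpa using card_sparseFamily_agree_le (a := ∅) (by decide) (0 : Pos → ZMod M × ZMod L)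

theorem le_card_sparseFamily : M * (M * L) ^ 5 ≤ (sparseFamily M L).card := by
  have hL : 0 < L := Nat.pos_of_ne_zero (NeZero.ne L)
  refine Nat.le_of_mul_le_mul_right ?_ hL
  have h1 : M * (M * L) ^ 5 * L = Fintype.card (Pos → ZMod M × ZMod L) := by
    rw [Fintype.card_fun, Fintype.card_prod, ZMod.card, ZMod.card,
      show Fintype.card Pos = 6 from rfl]
    ring
  have h2 : (sparseFamily M L).card * L =
      (sparseFamily M L ×ˢ (univ : Finset (ZMod L))).card := by
    rw [card_product, card_univ, ZMod.card]
  rw [h1, h2, ← card_univ]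
  let g : Pos → ZMod L → Pos → ZMod M × ZMod L := fun t₀ c => Pi.single t₀ (0, c)
  refine card_le_card_of_injOn
    (fun z => (z - g (0, false) (∑ t, (z t).2), ∑ t, (z t).2)) ?_ ?_
  · intro z _
    simp [sparseFamily, g, Pi.single_apply, apply_ite Prod.snd, sum_sub_distrib]
  · intro z _ z' _ h
    obtain ⟨h1, h2⟩ := Prod.mk.inj h
    rw [h2] at h1
    exact sub_left_injective h1

theorem le_card_sparseFamily_avoiding {m : ℕ} (hm : M * L = 12 * m)
    {U : Pos → Finset (ZMod M × ZMod L)} (hU : ∀ t, (U t).card ≤ m) :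
    M * (M * L) ^ 4 * (6 * m) ≤
      ((sparseFamily M L).filter fun z => ∀ t, z t ∉ U t).card := by
  have hsub : sparseFamily M L ⊆ ((sparseFamily M L).filter fun z => ∀ t, z t ∉ U t) ∪
      univ.biUnion fun t => (U t).biUnion fun u =>
        (sparseFamily M L).filter fun z => ∀ t' ∈ ({t} : Finset Pos), z t' = u := by
    intro z hz
    simp only [mem_union, mem_filter, hz, true_and, mem_biUnion, mem_univ, mem_singleton,
      forall_eq]
    by_cases h : ∀ t, z t ∉ U t
    · exact Or.inl h
    · push Not at h
      obtain ⟨t, ht⟩ := h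
      exact Or.inr ⟨t, z t, ht, rfl⟩
  have h1 : ∀ t : Pos, ((U t).biUnion fun u =>
      (sparseFamily M L).filter fun z => ∀ t' ∈ ({t} : Finset Pos), z t' = u).card
        ≤ m * (M * (M * L) ^ 4) := by
    intro t
    refine (card_biUnion_le_card_mul _ _ _ fun u _ => card_sparseFamily_agree_le
      (a := {t}) (fun h => ?_) fun _ => u).trans ?_
    · have := congrArg card h
      revert this
      rw [card_singleton]
      decide
    · exact Nat.mul_le_mul_right _ (hU t)
  have h2 := (card_le_card hsub).trans (card_union_le _ _)
  have h3 := card_biUnion_le_card_mul (univ : Finset Pos) _ _ fun t _ => h1 t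
  rw [show (univ : Finset Pos).card = 6 from rfl] at h3
  have h4 := (le_card_sparseFamily (M := M) (L := L)).trans h2
  rw [pow_succ, hm] at h4
  rw [hm] at h3 ⊢
  nlinarith

theorem sum_correlation_le {n : ℕ} (φ : ZMod 3 × (ZMod M × ZMod L) ↪ Fin n) {p B : ℝ}
    (h0 : 0 ≤ p) (h1 : p ≤ 1) (hB : 1 ≤ B) (hpB : M * L * p ≤ B) (hM : 128 * M * p ^ 2 * B ^ 3 ≤ 1)
    {F : Finset (Pos → ZMod M × ZMod L)} (hF : F ⊆ sparseFamily M L)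
    (z : Pos → ZMod M × ZMod L) :
    ∑ z' ∈ F with z' ≠ z ∧ ¬ Disjoint (arcs φ z') (arcs φ z), p ^ (arcs φ z' ∪ arcs φ z).card
      ≤ p ^ 6 / 2 := by
  have hmaps : ∀ z' ∈ F.filter (fun z' => z' ≠ z ∧ ¬ Disjoint (arcs φ z') (arcs φ z)),
      (univ.filter fun t => z' t = z t) ∈ (univ : Finset (Finset Pos)) := fun _ _ => mem_univ _
  rw [← sum_fiberwise_of_maps_to hmaps]
  have hterm : ∀ a : Finset Pos,
      ∑ z' ∈ F.filter (fun z' => z' ≠ z ∧ ¬ Disjoint (arcs φ z') (arcs φ z)) with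
        (univ.filter fun t => z' t = z t) = a, p ^ (arcs φ z' ∪ arcs φ z).card ≤ p ^ 6 / 128 := by
    intro a
    by_cases ha : 2 ≤ a.card ∧ a.card ≤ 5
    · have hau : a ≠ univ := by
        rintro rfl
        exact absurd ha.2 (by decide)
      have hle : ∀ z' ∈ (F.filter fun z' => z' ≠ z ∧ ¬ Disjoint (arcs φ z') (arcs φ z)).filter
          (fun z' => (univ.filter fun t => z' t = z t) = a),
          p ^ (arcs φ z' ∪ arcs φ z).card ≤ p ^ (13 - a.card) := by
        intro z' hz'
        simp only [mem_filter] at hz'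
        have := (card_arcs_union hz'.1.2.1 hz'.1.2.2).2.2
        rw [hz'.2] at this
        exact pow_le_pow_of_le_one h0 h1 this
      refine (sum_le_card_nsmul _ _ _ hle).trans ?_
      rw [nsmul_eq_mul]
      have hcard : ((F.filter fun z' => z' ≠ z ∧ ¬ Disjoint (arcs φ z') (arcs φ z)).filter
          (fun z' => (univ.filter fun t => z' t = z t) = a)).card ≤ M * (M * L) ^ (5 - a.card) := by
        refine (card_le_card fun z' hz' => ?_).trans (card_sparseFamily_agree_le hau z)
        simp only [mem_filter] at hz' ⊢
        refine ⟨hF hz'.1.1, fun t ht => ?_⟩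
        rw [← hz'.2] at ht
        simpa using ht
      have hcard' : (((F.filter fun z' => z' ≠ z ∧ ¬ Disjoint (arcs φ z') (arcs φ z)).filter
          (fun z' => (univ.filter fun t => z' t = z t) = a)).card : ℝ)
          ≤ M * (M * L) ^ (5 - a.card) := by exact_mod_cast hcard
      calc _ ≤ (M * (M * L) ^ (5 - a.card) : ℝ) * p ^ (13 - a.card) :=
            mul_le_mul_of_nonneg_right hcard' (pow_nonneg h0 _)
        _ = p ^ 6 * (M * p ^ 2) * (M * L * p) ^ (5 - a.card) := by
            rw [show 13 - a.card = 6 + 2 + (5 - a.card) by omega, pow_add, pow_add, mul_pow _ p]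
            ring
        _ ≤ p ^ 6 * (M * p ^ 2) * B ^ 3 := by
            refine mul_le_mul_of_nonneg_left ?_ (by positivity)
            exact (pow_le_pow_left₀ (by positivity) hpB _).trans
              (pow_le_pow_right₀ hB (by omega))
        _ ≤ p ^ 6 / 128 := by nlinarith [pow_nonneg h0 6]
    · rw [filter_eq_empty_iff.2, sum_empty]
      · positivity
      · rintro z' hz' rfl
        simp only [mem_filter] at hz'
        have := card_arcs_union hz'.2.1 hz'.2.2
        exact ha ⟨this.1, this.2.1⟩
  refine (sum_le_card_nsmul _ _ _ fun a _ => hterm a).trans (le_of_eq ?_)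
  rw [show (univ : Finset (Finset Pos)).card = 64 from rfl, nsmul_eq_mul]
  norm_num
  ring

/-- A bound for the probability that there is no stable 6-cycle. -/
theorem prob_no_stable_cycle_le {n m : ℕ} (hn : 3 * (M * L) ≤ n) (hm : M * L = 12 * m) {p B : ℝ}
    (h0 : 0 ≤ p) (h1 : p ≤ 1) (hB : 1 ≤ B) (hpB : M * L * p ≤ B)
    (hM : 128 * M * p ^ 2 * B ^ 3 ≤ 1) :
    prob p {s : Finset (Entry n) | ¬ ∃ r c : ZMod 3 → Fin n,
      IsStableCycle 3 n (matricesEquiv n s).1 (matricesEquiv n s).2 r c} ≤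
    (2 ^ (M * L)) ^ 6 * (1 - p ^ 6 / 2) ^ (M * (M * L) ^ 4 * (6 * m)) +
      (M * (M * L) ^ 5 * (18 * n) * p ^ 8) ^ m / m.factorial := by
  obtain ⟨φ⟩ : Nonempty (ZMod 3 × (ZMod M × ZMod L) ↪ Fin n) :=
    Function.Embedding.nonempty_of_card_le (by
      rw [Fintype.card_prod, Fintype.card_prod, ZMod.card, ZMod.card, ZMod.card, Fintype.card_fin]
      exact hn)
  have hp6 : p ^ 6 ≤ 1 := pow_le_one₀ h0 h1
  have hp6' : 0 ≤ p ^ 6 := pow_nonneg h0 6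
  let W : Finset (Pos → Finset (ZMod M × ZMod L)) := univ.filter fun U => ∀ t, (U t).card ≤ m
  let F : (Pos → Finset (ZMod M × ZMod L)) → Finset (Pos → ZMod M × ZMod L) :=
    fun U => (sparseFamily M L).filter fun z => ∀ t, z t ∉ U t
  let X := sparseFamily M L ×ˢ (univ : Finset (Bool × Fin n × ZMod 3 × ZMod 3))
  have hsub : {s : Finset (Entry n) | ¬ ∃ r c : ZMod 3 → Fin n,
      IsStableCycle 3 n (matricesEquiv n s).1 (matricesEquiv n s).2 r c} ⊆
      {s | ∃ U ∈ W, s ∈ {s | ∀ z ∈ F U, ¬ arcs φ z ⊆ s}} ∪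
      {s | ∃ K ∈ X.powersetCard m, (K.biUnion (unstableArcs φ)).card = 8 * m ∧
        K.biUnion (unstableArcs φ) ⊆ s} := by
    intro s hs
    refine (exists_avoiding_or_disjoint_unstable (φ := φ) hs (sparseFamily M L) m).imp ?_ id
    rintro ⟨U, hU, h⟩
    exact ⟨U, mem_filter.2 ⟨mem_univ _, hU⟩, h⟩
  refine ((prob_mono h0 h1 hsub).trans (prob_union_le h0 h1 _ _)).trans (add_le_add ?_ ?_)
  · have hU : ∀ U ∈ W, prob p {s | ∀ z ∈ F U, ¬ arcs φ z ⊆ s} ≤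
        (1 - p ^ 6 / 2) ^ (M * (M * L) ^ 4 * (6 * m)) := by
      intro U hU
      refine (prob_forall_not_superset_le h0 h1 (F U) (arcs φ) 6 (fun z _ => card_arcs z)
        fun z _ => sum_correlation_le φ h0 h1 hB hpB hM (filter_subset _ _) z).trans ?_
      exact pow_le_pow_of_le_one (by linarith) (by linarith)
        (le_card_sparseFamily_avoiding hm (mem_filter.1 hU).2)
    refine ((prob_biUnion_le h0 h1 _ _).trans (sum_le_card_nsmul _ _ _ hU)).trans ?_
    rw [nsmul_eq_mul]
    refine mul_le_mul_of_nonneg_right ?_ (pow_nonneg (by linarith) _)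
    have : W.card ≤ (2 ^ (M * L)) ^ 6 := by
      refine (card_le_univ _).trans (le_of_eq ?_)
      rw [Fintype.card_fun, Fintype.card_finset, Fintype.card_prod, ZMod.card, ZMod.card]
      rfl
    exact_mod_cast this
  · refine (prob_exists_disjoint_family_le h0 h1 X (unstableArcs φ) 8 m).trans ?_
    have hX : X.card ≤ M * (M * L) ^ 5 * (18 * n) := by
      rw [card_product]
      refine Nat.mul_le_mul card_sparseFamily_le (le_of_eq ?_)
      simp only [card_univ, Fintype.card_prod, Fintype.card_bool, Fintype.card_fin, ZMod.card]
      ring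
    have hX' : (X.card : ℝ) ≤ M * (M * L) ^ 5 * (18 * n) := by exact_mod_cast hX
    gcongr

end Sparse

end LayeredCycle

section Asymptotics

open LayeredCycle GameMeasure RandomSubset

theorem density_bounds {n a : ℕ} {p : ℝ} (ha : 1 ≤ a) (h₁ : 36 * a ^ 8 ≤ n)
    (h₂ : n ≤ 9216 * a ^ 8)
    (hlow : (n : ℝ) ^ (-(3 : ℝ) / 4 + 3 / (2 * Real.log n)) ≤ p)
    (hupp : p ≤ (n : ℝ) ^ (-(3 : ℝ) / 4 + 2 / Real.log n)) :
    1 / (1000 * (a : ℝ) ^ 6) ≤ p ∧ p ≤ 1 / (a : ℝ) ^ 6 := by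
  have ha' : (1 : ℝ) ≤ a := by exact_mod_cast ha
  have h₁' : 36 * (a : ℝ) ^ 8 ≤ n := by exact_mod_cast h₁
  have h₂' : (n : ℝ) ≤ 9216 * (a : ℝ) ^ 8 := by exact_mod_cast h₂
  have ha8 : (1 : ℝ) ≤ (a : ℝ) ^ 8 := one_le_pow₀ ha'
  have hn : (1 : ℝ) < n := by linarith
  have hn0 : (0 : ℝ) < n := by linarith
  have hlog : 0 < Real.log n := Real.log_pos hn
  have hpow : ∀ c : ℝ, (n : ℝ) ^ (c / Real.log n) = Real.exp c := by
    intro c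
    rw [Real.rpow_def_of_pos hn0, mul_div_cancel₀ _ hlog.ne']
  have hroot : ∀ y : ℝ, 0 ≤ y → (y ^ 4) ^ ((3 : ℝ) / 4) = y ^ 3 := by
    intro y hy
    rw [← Real.rpow_natCast y 4, ← Real.rpow_mul hy, ← Real.rpow_natCast y 3]
    norm_num
  have hge : 8 * (a : ℝ) ^ 6 ≤ (n : ℝ) ^ ((3 : ℝ) / 4) := by
    have := Real.rpow_le_rpow (z := 3 / 4) (by positivity)
      (show (2 * (a : ℝ) ^ 2) ^ 4 ≤ n by nlinarith) (by norm_num)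
    rw [hroot _ (by positivity)] at this
    linarith
  have hle : (n : ℝ) ^ ((3 : ℝ) / 4) ≤ 1000 * (a : ℝ) ^ 6 := by
    have := Real.rpow_le_rpow (z := 3 / 4) hn0.le
      (show (n : ℝ) ≤ (10 * (a : ℝ) ^ 2) ^ 4 by nlinarith) (by norm_num)
    rw [hroot _ (by positivity)] at this
    linarith
  have hneg : (n : ℝ) ^ (-(3 : ℝ) / 4) = 1 / (n : ℝ) ^ ((3 : ℝ) / 4) := by
    rw [neg_div, Real.rpow_neg hn0.le, one_div]
  have hpos : 0 < (n : ℝ) ^ ((3 : ℝ) / 4) := Real.rpow_pos_of_pos hn0 _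
  have ha6 : 0 < (a : ℝ) ^ 6 := by positivity
  constructor
  · refine le_trans ?_ hlow
    rw [Real.rpow_add hn0, show (3 : ℝ) / (2 * Real.log n) = 3 / 2 / Real.log n by rw [div_div],
      hpow, hneg]
    refine (one_div_le_one_div_of_le hpos hle).trans ?_
    exact le_mul_of_one_le_right (by positivity) (Real.one_le_exp (by norm_num))
  · refine hupp.trans ?_
    have he : Real.exp 2 ≤ 8 := by
      have h := Real.exp_one_lt_d9
      have h' : Real.exp 2 = Real.exp 1 * Real.exp 1 := by
        rw [← Real.exp_add]; norm_num
      nlinarith [Real.exp_pos 1]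
    rw [Real.rpow_add hn0, hpow, hneg, one_div_mul_eq_div, div_le_div_iff₀ hpos ha6]
    nlinarith

theorem scaled_prob_no_stable_cycle_le {n a : ℕ} {p : ℝ} (ha : 128 * 12 ^ 4 ≤ a)
    (h₁ : 36 * a ^ 8 ≤ n) (h₂ : n ≤ 9216 * a ^ 8)
    (hlow : 1 / (1000 * (a : ℝ) ^ 6) ≤ p) (hupp : p ≤ 1 / (a : ℝ) ^ 6) :
    (2.598 : ℝ) ^ n * prob p {s : Finset (Entry n) | ¬ ∃ r c : ZMod 3 → Fin n,
      IsStableCycle 3 n (matricesEquiv n s).1 (matricesEquiv n s).2 r c} ≤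
    (3 ^ 9216 * 2 ^ 72 * Real.exp (-(a / 1000 ^ 6))) ^ (a ^ 8) +
      (3 ^ 9216 * (12 ^ 6 * 18 * 9216 * 3) / a) ^ (a ^ 8) := by
  have ha0 : a ≠ 0 := by omega
  have ha1 : (1 : ℝ) ≤ a := by exact_mod_cast Nat.one_le_iff_ne_zero.2 ha0
  have hapos : (0 : ℝ) < a := by linarith
  have haR : (128 * 12 ^ 4 : ℝ) ≤ a := by exact_mod_cast ha
  have : NeZero (12 * a ^ 5) := ⟨by positivity⟩
  have : NeZero (a ^ 3) := ⟨by positivity⟩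
  have h0 : 0 ≤ p := le_trans (by positivity) hlow
  have hpa : p * (a : ℝ) ^ 6 ≤ 1 := by rwa [le_div_iff₀ (by positivity)] at hupp
  have h1 : p ≤ 1 := hupp.trans (div_le_one_of_le₀ (one_le_pow₀ ha1) (by positivity))
  have hML : 12 * a ^ 5 * a ^ 3 = 12 * a ^ 8 := by ring
  have key := prob_no_stable_cycle_le (M := 12 * a ^ 5) (L := a ^ 3) (n := n) (m := a ^ 8)
    (by rw [hML]; linarith) hML (B := 12 * (a : ℝ) ^ 2) h0 h1 (by nlinarith)
    (by
      push_cast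
      nlinarith [mul_le_mul_of_nonneg_left hpa (show (0 : ℝ) ≤ 12 * (a : ℝ) ^ 2 by positivity)])
    (by
      push_cast
      have hsq : (p * (a : ℝ) ^ 6) ^ 2 ≤ 1 := pow_le_one₀ (by positivity) hpa
      refine le_of_mul_le_mul_right ?_ hapos
      calc 128 * (12 * (a : ℝ) ^ 5) * p ^ 2 * (12 * (a : ℝ) ^ 2) ^ 3 * (a : ℝ)
          = 128 * 12 ^ 4 * (p * (a : ℝ) ^ 6) ^ 2 := by ring
        _ ≤ 1 * (a : ℝ) := by nlinarith)
  rw [hML] at key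
  have hexp : (2.598 : ℝ) ^ n ≤ ((3 : ℝ) ^ 9216) ^ (a ^ 8) := by
    rw [← pow_mul]
    exact (pow_le_pow_left₀ (by norm_num) (by norm_num : (2.598 : ℝ) ≤ 3) n).trans
      (pow_le_pow_right₀ (by norm_num) h₂)
  have hC : (0 : ℝ) ≤ 3 ^ 9216 := by positivity
  generalize (3 : ℝ) ^ 9216 = C at hexp hC ⊢
  have hfirst : ((2 : ℝ) ^ (12 * a ^ 8)) ^ 6 *
      (1 - p ^ 6 / 2) ^ (12 * a ^ 5 * (12 * a ^ 8) ^ 4 * (6 * a ^ 8)) ≤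
      (2 ^ 72 * Real.exp (-(a / 1000 ^ 6))) ^ (a ^ 8) := by
    rw [mul_pow ((2 : ℝ) ^ 72)]
    refine mul_le_mul (le_of_eq ?_) ?_ ?_ ?_
    · rw [← pow_mul, ← pow_mul]
      congr 1
      ring
    · have hle : 1 - p ^ 6 / 2 ≤ Real.exp (-(p ^ 6 / 2)) := by
        have := Real.add_one_le_exp (-(p ^ 6 / 2))
        linarith
      have hp6 : p ^ 6 ≤ 1 := pow_le_one₀ h0 h1
      refine (pow_le_pow_left₀ (by linarith) hle _).trans ?_
      rw [← Real.exp_nat_mul, ← Real.exp_nat_mul, Real.exp_le_exp, mul_neg, mul_neg, neg_le_neg_iff]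
      push_cast
      have hp : 1 / 1000 ≤ p * (a : ℝ) ^ 6 := by
        rw [div_le_iff₀ (by positivity)] at hlow
        linarith
      have hp' := pow_le_pow_left₀ (by norm_num) hp 6
      calc (a : ℝ) ^ 8 * (a / 1000 ^ 6) = (a : ℝ) ^ 9 * (1 / 1000) ^ 6 := by ring
        _ ≤ (a : ℝ) ^ 9 * (p * (a : ℝ) ^ 6) ^ 6 := by gcongr
        _ ≤ (3 * 12 ^ 5) * ((a : ℝ) ^ 9 * (p * (a : ℝ) ^ 6) ^ 6) :=
            le_mul_of_one_le_left (by positivity) (by norm_num)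
        _ = _ := by ring
    · have hp6 : p ^ 6 ≤ 1 := pow_le_one₀ h0 h1
      exact pow_nonneg (by linarith) _
    · positivity
  have hsecond : ((12 * (a : ℝ) ^ 5) * (12 * (a : ℝ) ^ 8) ^ 5 * (18 * n) * p ^ 8) ^ (a ^ 8) /
      (a ^ 8).factorial ≤ ((12 ^ 6 * 18 * 9216 * 3) / a) ^ (a ^ 8) := by
    have hn : (n : ℝ) ≤ 9216 * (a : ℝ) ^ 8 := by exact_mod_cast h₂
    have hbase : (12 * (a : ℝ) ^ 5) * (12 * (a : ℝ) ^ 8) ^ 5 * (18 * n) * p ^ 8 ≤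
        (12 ^ 6 * 18 * 9216 / a) * (a : ℝ) ^ 8 := by
      calc (12 * (a : ℝ) ^ 5) * (12 * (a : ℝ) ^ 8) ^ 5 * (18 * n) * p ^ 8
          ≤ (12 * (a : ℝ) ^ 5) * (12 * (a : ℝ) ^ 8) ^ 5 * (18 * (9216 * (a : ℝ) ^ 8)) * p ^ 8 := by
            gcongr
        _ = (12 ^ 6 * 18 * 9216) * (a : ℝ) ^ 5 * (p * (a : ℝ) ^ 6) ^ 8 := by ring
        _ ≤ (12 ^ 6 * 18 * 9216) * (a : ℝ) ^ 5 * 1 := by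
            gcongr
            exact pow_le_one₀ (by positivity) hpa
        _ ≤ (12 ^ 6 * 18 * 9216) * (a : ℝ) ^ 7 := by
            rw [mul_one]
            gcongr
            norm_num
        _ = _ := by field_simp
    calc _ ≤ ((12 ^ 6 * 18 * 9216 / a) * (a : ℝ) ^ 8) ^ (a ^ 8) / (a ^ 8).factorial := by
          gcongr
      _ = (12 ^ 6 * 18 * 9216 / a) ^ (a ^ 8) *
          (((a ^ 8 : ℕ) : ℝ) ^ (a ^ 8) / (a ^ 8).factorial) := by
          rw [mul_pow (12 ^ 6 * 18 * 9216 / (a : ℝ)), mul_div_assoc]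
          push_cast
          rfl
      _ ≤ (12 ^ 6 * 18 * 9216 / a) ^ (a ^ 8) * Real.exp 1 ^ (a ^ 8) := by
          gcongr
          refine (Real.pow_div_factorial_le_exp _ (Nat.cast_nonneg _) _).trans (le_of_eq ?_)
          rw [← Real.exp_nat_mul, mul_one]
      _ ≤ (12 ^ 6 * 18 * 9216 / a) ^ (a ^ 8) * 3 ^ (a ^ 8) := by
          gcongr
          linarith [Real.exp_one_lt_d9]
      _ = _ := by rw [← mul_pow, div_mul_eq_mul_div]
  push_cast at key
  rw [show 12 * (a : ℝ) ^ 5 * (a : ℝ) ^ 3 = 12 * (a : ℝ) ^ 8 by ring] at key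
  calc _ ≤ C ^ (a ^ 8) * ((2 ^ 72 * Real.exp (-(a / 1000 ^ 6))) ^ (a ^ 8) +
        ((12 ^ 6 * 18 * 9216 * 3) / a) ^ (a ^ 8)) :=
        mul_le_mul hexp (key.trans (add_le_add hfirst hsecond)) (prob_nonneg h0 h1 _)
          (by positivity)
    _ = _ := by rw [mul_add, ← mul_pow, ← mul_pow, mul_assoc C, mul_div_assoc C]

theorem tendsto_pow_pow_eight {f : ℕ → ℝ} (hf₀ : ∀ a, 0 ≤ f a) (hf : Tendsto f atTop (nhds 0)) :
    Tendsto (fun a => f a ^ (a ^ 8)) atTop (nhds 0) := by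
  refine squeeze_zero' (Eventually.of_forall fun a => pow_nonneg (hf₀ a) _) ?_
    (tendsto_pow_atTop_nhds_zero_of_lt_one (r := (1 / 2 : ℝ)) (by norm_num) (by norm_num))
  filter_upwards [hf.eventually_le_const (show (0 : ℝ) < 1 / 2 by norm_num)] with a ha
  exact (pow_le_pow_left₀ (hf₀ a) ha _).trans
    (pow_le_pow_of_le_one (by norm_num) (by norm_num) (Nat.le_self_pow (by norm_num) a))

theorem exists_eighth_root_scale : ∃ a : ℕ → ℕ, Tendsto a atTop atTop ∧
    ∀ᶠ n in atTop, 36 * a n ^ 8 ≤ n ∧ n ≤ 9216 * a n ^ 8 := by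
  have hlim : Tendsto (fun n : ℕ => ⌊((n : ℝ) / 36) ^ ((1 : ℝ) / 8)⌋₊) atTop atTop :=
    tendsto_nat_floor_atTop.comp ((tendsto_rpow_atTop (by norm_num)).comp
      (tendsto_natCast_atTop_atTop.atTop_div_const (by norm_num)))
  refine ⟨_, hlim, ?_⟩
  filter_upwards [hlim.eventually_ge_atTop 1] with n hn
  set x : ℝ := ((n : ℝ) / 36) ^ ((1 : ℝ) / 8) with hx
  have hx0 : 0 ≤ x := by positivity
  have hx8 : x ^ 8 = n / 36 := by
    rw [hx, ← Real.rpow_natCast, ← Real.rpow_mul (by positivity)]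
    norm_num
  have hn' : (1 : ℝ) ≤ ⌊x⌋₊ := by exact_mod_cast hn
  constructor
  · have := pow_le_pow_left₀ (Nat.cast_nonneg _) (Nat.floor_le hx0) 8
    rw [hx8] at this
    exact_mod_cast (by linarith : 36 * (⌊x⌋₊ : ℝ) ^ 8 ≤ n)
  · have := pow_le_pow_left₀ hx0
      (show x ≤ 2 * (⌊x⌋₊ : ℝ) by linarith [Nat.lt_floor_add_one x]) 8
    rw [hx8, mul_pow] at this
    exact_mod_cast (by linarith : (n : ℝ) ≤ 9216 * (⌊x⌋₊ : ℝ) ^ 8)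

end Asymptotics

theorem gap_two_failure_prob (p : ℕ → ℝ) (hp : ∀ n, 0 ≤ p n ∧ p n ≤ 1)
    (hrange : ∀ᶠ n : ℕ in atTop,
      (n : ℝ) ^ (-(3 : ℝ) / 4 + 3 / (2 * Real.log n)) ≤ p n ∧
        p n ≤ (n : ℝ) ^ (-(3 : ℝ) / 4 + 2 / Real.log n)) :
    Tendsto
      (fun n : ℕ => (2.598 : ℝ) ^ n *
        (gameMeasure n (p n)
          {ω | ¬ ∃ r c : ZMod 3 → Fin n, IsStableCycle 3 n ω.1 ω.2 r c}).toReal)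
      atTop (nhds 0) := by
  obtain ⟨a, ha, hscale⟩ := exists_eighth_root_scale
  have hlim₁ : Tendsto (fun a : ℕ => (3 : ℝ) ^ 9216 * 2 ^ 72 * Real.exp (-(a / 1000 ^ 6))) atTop
      (nhds 0) := by
    have := (Real.tendsto_exp_neg_atTop_nhds_zero.comp
      ((tendsto_natCast_atTop_atTop (R := ℝ)).atTop_div_const
        (show (0 : ℝ) < 1000 ^ 6 by norm_num))).const_mul ((3 : ℝ) ^ 9216 * 2 ^ 72)
    rwa [mul_zero] at this
  have hlim₂ : Tendsto (fun a : ℕ => (3 : ℝ) ^ 9216 * (12 ^ 6 * 18 * 9216 * 3) / a) atTop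
      (nhds 0) := tendsto_const_div_atTop_nhds_zero_nat _
  have hlim := ((tendsto_pow_pow_eight (fun a => by positivity) hlim₁).add
    (tendsto_pow_pow_eight (fun a => by positivity) hlim₂)).comp ha
  rw [add_zero] at hlim
  refine squeeze_zero' (Eventually.of_forall fun n => by positivity) ?_ hlim
  filter_upwards [hrange, hscale, ha.eventually_ge_atTop (128 * 12 ^ 4)] with n hn hs han
  obtain ⟨hlow, hupp⟩ := density_bounds (by omega) hs.1 hs.2 hn.1 hn.2
  rw [GameMeasure.toReal_gameMeasure n (hp n).1 (hp n).2]
  exact scaled_prob_no_stable_cycle_le han hs.1 hs.2 hlow hupp
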